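/- Let Γ be a countable discrete abelian group, X = (X, 𝒳, μ, (T_g)) an ergodic Γ-system with k-th Host–Kra factor Z^k, and let Z̃^k be an ergodic Γ-system of order k that extends Z^k. Then the relatively independent joining X̃ = X ×_{Z^k} Z̃^k is an extension of X whose Host–Kra factor of order k equals Z̃^k. Concretely: every function on X̃ that is measurable with respect to the order-k Host–Kra factor of X̃ is measurable with respect to the factor Z̃^k. -/

import Mathlib

open Filter Finset MeasureTheory

section UC
variable {Γ : Type*} [AddCommGroup Γ] [DecidableEq Γ]

/-- A Følner sequence in a countable discrete abelian group: a sequence of nonempty finite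
subsets which is asymptotically invariant under every translation. -/
def IsFolner (Φ : ℕ → Finset Γ) : Prop :=
  (∀ N, (Φ N).Nonempty) ∧
  ∀ x : Γ, Tendsto
    (fun N => ((symmDiff ((Φ N).image (· + x)) (Φ N)).card : ℝ) / (Φ N).card) atTop (nhds 0)

/-- `UCLim v L`: the uniform Cesàro limit of `v` equals `L`, i.e. the averages of `v` along
every Følner sequence converge to `L`. -/
def UCLim {E : Type*} [AddCommGroup E] [Module ℝ E] [TopologicalSpace E]
    (v : Γ → E) (L : E) : Prop :=
  ∀ Φ : ℕ → Finset Γ, IsFolner Φ →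
    Tendsto (fun N => (((Φ N).card : ℝ)⁻¹) • ∑ g ∈ Φ N, v g) atTop (nhds L)

end UC

/-- The Gowers–Host–Kra product of order `k`: the product over all subsets `s ⊆ {1,…,k}` of
`f (T_{∑_{i∈s} g_i} x)` (for real-valued `f`, conjugation is trivial). -/
def gowersProd {Γ W : Type*} [AddCommGroup Γ] (k : ℕ) (T : Γ → W → W) (f : W → ℝ)
    (gs : Fin k → Γ) (x : W) : ℝ :=
  ∏ s : Finset (Fin k), f (T (∑ i ∈ s, gs i) x)

/-- The Host–Kra seminorm of order `k` of `f` vanishes: the uniform Cesàro limit (over the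
group `Γ^k`) of the integrals of the Gowers–Host–Kra products of `f` is zero. -/
def HKSeminormZero {Γ W : Type*} [AddCommGroup Γ] [DecidableEq Γ] [MeasurableSpace W]
    (k : ℕ) (T : Γ → W → W) (m : MeasureTheory.Measure W) (f : W → ℝ) : Prop :=
  UCLim (fun gs : Fin k → Γ => ∫ x, gowersProd k T f gs x ∂m) 0


set_option linter.unusedSectionVars false

namespace HKaux

/-- Finite average. -/
noncomputable def avg {ι : Type*} (A : Finset ι) (a : ι → ℝ) : ℝ :=
  ((A.card : ℝ)⁻¹) • ∑ g ∈ A, a g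

section avg
variable {ι κ : Type*}

lemma avg_comm (A : Finset ι) (B : Finset κ) (a : ι → κ → ℝ) :
    avg A (fun i => avg B (fun j => a i j)) = avg B (fun j => avg A (fun i => a i j)) := by
  simp only [avg, smul_eq_mul, Finset.mul_sum]
  rw [Finset.sum_comm]
  refine Finset.sum_congr rfl fun _ _ => Finset.sum_congr rfl fun _ _ => by ring

lemma avg_sub (A : Finset ι) (a b : ι → ℝ) :
    avg A (fun i => a i - b i) = avg A a - avg A b := by
  simp only [avg, smul_eq_mul, Finset.sum_sub_distrib]; ring

lemma avg_const {A : Finset ι} (hA : A.Nonempty) (c : ℝ) : avg A (fun _ => c) = c := by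
  have : (A.card : ℝ) ≠ 0 := by exact_mod_cast hA.card_pos.ne'
  simp only [avg, smul_eq_mul, Finset.sum_const, nsmul_eq_mul]
  field_simp

lemma avg_mono {A : Finset ι} {a b : ι → ℝ} (h : ∀ i ∈ A, a i ≤ b i) : avg A a ≤ avg A b := by
  simp only [avg, smul_eq_mul]
  exact mul_le_mul_of_nonneg_left (Finset.sum_le_sum h) (by positivity)

lemma abs_avg_le (A : Finset ι) (a : ι → ℝ) : |avg A a| ≤ avg A (fun i => |a i|) := by
  simp only [avg, smul_eq_mul, abs_mul]
  rw [abs_of_nonneg (by positivity : (0:ℝ) ≤ (A.card : ℝ)⁻¹)]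
  exact mul_le_mul_of_nonneg_left (Finset.abs_sum_le_sum_abs _ _) (by positivity)

lemma abs_avg_le_const {A : Finset ι} (hA : A.Nonempty) {a : ι → ℝ} {c : ℝ}
    (h : ∀ i ∈ A, |a i| ≤ c) : |avg A a| ≤ c :=
  (abs_avg_le A a).trans ((avg_mono h).trans_eq (avg_const hA c))

lemma avg_congr {A : Finset ι} {a b : ι → ℝ} (h : ∀ i ∈ A, a i = b i) : avg A a = avg A b := by
  simp only [avg, Finset.sum_congr rfl h]

lemma avg_pow_le {A : Finset ι} (hA : A.Nonempty) (a : ι → ℝ) {n : ℕ} (hn : Even n) :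
    avg A a ^ n ≤ avg A (fun i => a i ^ n) := by
  have h0 : (A.card : ℝ) ≠ 0 := by exact_mod_cast hA.card_pos.ne'
  have := Real.pow_arith_mean_le_arith_mean_pow_of_even A (fun _ => (A.card : ℝ)⁻¹) a
    (fun _ _ => by positivity) (by simp [h0]) hn
  simpa only [avg, smul_eq_mul, Finset.mul_sum] using this

lemma avg_pow_two_pow_le {A : Finset ι} (hA : A.Nonempty) (a : ι → ℝ) (d : ℕ) :
    avg A a ^ (2 ^ d) ≤ avg A (fun i => a i ^ (2 ^ d)) := by
  rcases Nat.eq_zero_or_pos d with rfl | hd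
  · simp
  · exact avg_pow_le hA a ((Nat.even_pow.2 ⟨even_two, hd.ne'⟩))

lemma avg_integral {W : Type*} [MeasurableSpace W] (m : Measure W) (A : Finset ι)
    (a : ι → W → ℝ) (h : ∀ i, Integrable (a i) m) :
    avg A (fun i => ∫ w, a i w ∂m) = ∫ w, avg A (fun i => a i w) ∂m := by
  simp only [avg, smul_eq_mul]
  rw [integral_const_mul, integral_finsetSum _ (fun i _ => h i)]

end avg

section folner
variable {G : Type*} [AddCommGroup G] [DecidableEq G]

lemma avg_shift (A : Finset G) (x : G) (a : G → ℝ) {C : ℝ} (ha : ∀ g, |a g| ≤ C) :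
    |avg A (fun g => a (g + x)) - avg A a| ≤
      ((symmDiff (A.image (· + x)) A).card : ℝ) / A.card * C := by
  have h1 : ∑ g ∈ A, a (g + x) = ∑ g ∈ A.image (· + x), a g := by
    rw [Finset.sum_image (fun a _ b _ h => add_right_cancel h)]
  simp only [avg, smul_eq_mul, h1]
  set B := A.image (· + x)
  rw [← mul_sub, ← Finset.sum_sdiff_sub_sum_sdiff, abs_mul,
    abs_of_nonneg (by positivity : (0:ℝ) ≤ (A.card : ℝ)⁻¹), div_mul_eq_mul_div, div_eq_inv_mul]
  refine mul_le_mul_of_nonneg_left ?_ (by positivity)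
  have e : ∀ s : Finset G, |∑ g ∈ s, a g| ≤ s.card * C := fun s =>
    (Finset.abs_sum_le_sum_abs _ _).trans
      ((Finset.sum_le_sum (fun g _ => ha g)).trans (by simp))
  have hc : (symmDiff B A).card = (B \ A).card + (A \ B).card := by
    rw [symmDiff_def, Finset.sup_eq_union, Finset.card_union_of_disjoint disjoint_sdiff_sdiff]
  rw [hc]; push_cast
  have := e (B \ A); have := e (A \ B)
  calc _ ≤ |∑ g ∈ B \ A, a g| + |∑ g ∈ A \ B, a g| := abs_sub _ _
    _ ≤ _ := by linarith

lemma avg_shift_tendsto {Φ : ℕ → Finset G} (hΦ : IsFolner Φ) (x : G) (a : G → ℝ) {C : ℝ}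
    (ha : ∀ g, |a g| ≤ C) :
    Tendsto (fun N => avg (Φ N) (fun g => a (g + x)) - avg (Φ N) a) atTop (nhds 0) := by
  refine squeeze_zero_norm (fun N => avg_shift (Φ N) x a ha) ?_
  simpa using (hΦ.2 x).mul_const C

lemma isFolner_translate {Φ : ℕ → Finset G} (hΦ : IsFolner Φ) (v : ℕ → G) :
    IsFolner (fun N => (Φ N).image (· - v N)) := by
  refine ⟨fun N => (hΦ.1 N).image _, fun x => ?_⟩
  refine (hΦ.2 x).congr fun N => ?_
  have inj : Function.Injective (fun g : G => g - v N) := sub_left_injective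
  have e : ((Φ N).image (· - v N)).image (· + x) = ((Φ N).image (· + x)).image (· - v N) := by
    simp only [Finset.image_image]; congr 1; ext g; simp [sub_add_eq_add_sub]
  rw [e, ← Finset.image_symmDiff _ _ inj, Finset.card_image_of_injective _ inj,
    Finset.card_image_of_injective _ inj]

/-- Generalized arithmetic progression. -/
def gap (e : ℕ → G) (n m : ℕ) : Finset G :=
  (Fintype.piFinset (fun _ : Fin n => Finset.range m)).image
    (fun a : Fin n → ℕ => ∑ i : Fin n, a i • e i)

lemma gap_card_le (e : ℕ → G) (n m : ℕ) : (gap e n m).card ≤ m ^ n := by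
  refine Finset.card_image_le.trans ?_
  simp [Fintype.card_piFinset]

lemma gap_mono (e : ℕ → G) (n m : ℕ) : gap e n m ⊆ gap e n (m + 1) := by
  refine Finset.image_subset_image ?_
  exact Fintype.piFinset_subset _ _ (fun _ => Finset.range_mono (Nat.le_succ m))

lemma gap_add (e : ℕ → G) (n m j : ℕ) (hj : j < n) :
    (gap e n m).image (· + e j) ⊆ gap e n (m + 1) := by
  intro y hy
  simp only [gap, Finset.mem_image, Fintype.mem_piFinset, Finset.mem_range] at hy ⊢
  obtain ⟨_, ⟨a, ha, rfl⟩, rfl⟩ := hy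
  refine ⟨a + Pi.single ⟨j, hj⟩ 1, fun i => ?_, ?_⟩
  · have := ha i
    by_cases h : i = ⟨j, hj⟩
    · subst h; simp; omega
    · simp [h]; omega
  · simp only [Pi.add_apply, add_smul, Finset.sum_add_distrib]
    congr 1
    rw [Finset.sum_eq_single ⟨j, hj⟩] <;> simp +contextual

lemma gap_nonempty (e : ℕ → G) (n m : ℕ) : (gap e n (m + 1)).Nonempty := by
  refine Finset.Nonempty.image ⟨fun _ => 0, ?_⟩ _
  simp

lemma exists_gap_growth (e : ℕ → G) (n : ℕ) :
    ∃ m : ℕ, ((gap e n (m + 2)).card : ℝ) ≤ (1 + 1 / ((n : ℝ) + 1)) * (gap e n (m + 1)).card := by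
  by_contra! hcon
  set r : ℝ := 1 + 1 / ((n : ℝ) + 1) with hr
  have hr1 : 1 < r := by rw [hr]; have : (0:ℝ) < 1 / ((n : ℝ) + 1) := by positivity
                         linarith
  have h1 : ∀ m, r ^ m ≤ (gap e n (m + 1)).card := by
    intro m
    induction m with
    | zero => simpa using (gap_nonempty e n 0)
    | succ m ih =>
      rw [pow_succ']
      exact (mul_le_mul_of_nonneg_left ih (by linarith)).trans (hcon m).le
  have h2 := tendsto_pow_const_div_const_pow_of_one_lt n hr1
  have h3 := (h2.comp (tendsto_add_atTop_nat 1)).eventually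
    (gt_mem_nhds (show (0:ℝ) < r⁻¹ by positivity))
  obtain ⟨m, hm⟩ := h3.exists
  simp only [Function.comp] at hm
  have h4 : r ^ m ≤ ((m + 1 : ℕ) : ℝ) ^ n := (h1 m).trans (by exact_mod_cast gap_card_le e n (m+1))
  rw [div_lt_iff₀ (by positivity), pow_succ', inv_mul_cancel_left₀ (by positivity)] at hm
  linarith

lemma exists_folner (G : Type*) [AddCommGroup G] [DecidableEq G] [Countable G] :
    ∃ Φ : ℕ → Finset G, IsFolner Φ := by
  obtain ⟨e, he⟩ := exists_surjective_nat G
  choose m hm using exists_gap_growth e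
  refine ⟨fun n => gap e n (m n + 1), fun n => gap_nonempty _ _ _, fun x => ?_⟩
  obtain ⟨j, rfl⟩ := he x
  have hlim : Tendsto (fun n : ℕ => 2 * (1 / ((n : ℝ) + 1))) atTop (nhds 0) := by
    simpa using (tendsto_one_div_add_atTop_nhds_zero_nat (𝕜 := ℝ)).const_mul 2
  refine squeeze_zero' (Eventually.of_forall fun n => by positivity) ?_ hlim
  filter_upwards [eventually_gt_atTop j] with n hn
  set A := gap e n (m n + 1)
  set B := A.image (· + e j)
  set U := gap e n (m n + 2)
  have hA : A ⊆ U := gap_mono _ _ _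
  have hB : B ⊆ U := gap_add _ _ _ _ hn
  have hpos : (0:ℝ) < A.card := by exact_mod_cast (gap_nonempty e n (m n)).card_pos
  have hBA : B.card = A.card := Finset.card_image_of_injective _ (add_left_injective _)
  have hc : (symmDiff B A).card ≤ (U \ A).card + (U \ B).card := by
    rw [symmDiff_def, Finset.sup_eq_union]
    exact (Finset.card_union_le _ _).trans (add_le_add
      (Finset.card_le_card (Finset.sdiff_subset_sdiff hB le_rfl))
      (Finset.card_le_card (Finset.sdiff_subset_sdiff hA le_rfl)))
  have e1 := Finset.card_sdiff_add_card_eq_card hA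
  have e2 := Finset.card_sdiff_add_card_eq_card hB
  have hU := hm n
  have hc' : ((symmDiff B A).card : ℝ) ≤ 2 * (U.card - A.card) := by
    have e1' : ((U \ A).card : ℝ) + A.card = U.card := by exact_mod_cast e1
    have e2' : ((U \ B).card : ℝ) + A.card = U.card := by rw [← hBA]; exact_mod_cast e2
    have : ((symmDiff B A).card : ℝ) ≤ (U \ A).card + (U \ B).card := by exact_mod_cast hc
    linarith
  rw [div_le_iff₀ hpos]
  have : (U.card : ℝ) ≤ (1 + 1 / ((n : ℝ) + 1)) * A.card := hU
  nlinarith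

/-- The box `K ^ d`. -/
def box (d : ℕ) (K : Finset G) : Finset (Fin d → G) := Fintype.piFinset (fun _ => K)

lemma box_nonempty (d : ℕ) {K : Finset G} (hK : K.Nonempty) : (box d K).Nonempty := by
  simpa [box, Fintype.piFinset_nonempty] using fun _ => hK

lemma card_box (d : ℕ) (K : Finset G) : (box d K).card = K.card ^ d := by
  simp [box, Fintype.card_piFinset]

lemma card_pi_sdiff_le (d : ℕ) (A B : Fin d → Finset G) (m : ℕ) (hA : ∀ i, (A i).card = m) :
    ((Fintype.piFinset A \ Fintype.piFinset B).card : ℝ) * m ≤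
      (∑ i, ((A i \ B i).card : ℝ)) * m ^ d := by
  have h1 : Fintype.piFinset A \ Fintype.piFinset B ⊆
      Finset.univ.biUnion (fun i => Fintype.piFinset (Function.update A i (A i \ B i))) := by
    intro u hu
    simp only [Finset.mem_sdiff, Fintype.mem_piFinset, not_forall, Finset.mem_biUnion,
      Finset.mem_univ, true_and] at hu ⊢
    obtain ⟨hu, i, hi⟩ := hu
    refine ⟨i, fun j => ?_⟩
    by_cases h : j = i
    · subst h; simp [hu, hi]
    · simp [h, hu]
  have h2 := (Finset.card_le_card h1).trans Finset.card_biUnion_le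
  have h3 : ∀ i, (Fintype.piFinset (Function.update A i (A i \ B i))).card * m
      = (A i \ B i).card * m ^ d := by
    intro i
    rw [Fintype.card_piFinset, ← Finset.mul_prod_erase _ _ (Finset.mem_univ i)]
    have : ∏ x ∈ Finset.univ.erase i, (Function.update A i (A i \ B i) x).card = m ^ (d - 1) := by
      rw [Finset.prod_congr rfl (g := fun _ => m)]
      · simp
      · intro x hx; simp [Finset.ne_of_mem_erase hx, hA]
    rw [this]
    have hd : d = d - 1 + 1 := by have := i.2; omega
    conv_rhs => rw [hd, pow_succ]
    simp [mul_assoc]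
  have h4 : (Fintype.piFinset A \ Fintype.piFinset B).card * m ≤
      (∑ i, (A i \ B i).card) * m ^ d := by
    refine (Nat.mul_le_mul_right m h2).trans ?_
    rw [Finset.sum_mul, Finset.sum_mul]
    exact (Finset.sum_congr rfl fun i _ => h3 i).le
  exact_mod_cast h4

lemma isFolner_box (d : ℕ) {Φ : ℕ → Finset G} (hΦ : IsFolner Φ) :
    IsFolner (fun N => box d (Φ N)) := by
  refine ⟨fun N => box_nonempty d (hΦ.1 N), fun x => ?_⟩
  have hlim : Tendsto (fun N => ∑ i, ((symmDiff ((Φ N).image (· + x i)) (Φ N)).card : ℝ) /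
      (Φ N).card) atTop (nhds 0) := by
    have := tendsto_finsetSum (Finset.univ : Finset (Fin d)) (fun i _ => hΦ.2 (x i))
    simpa using this
  refine squeeze_zero (fun n => by positivity) (fun N => ?_) hlim
  set K := Φ N
  have hpos : (0:ℝ) < K.card := by exact_mod_cast (hΦ.1 N).card_pos
  have e : (box d K).image (· + x) = Fintype.piFinset (fun i => K.image (· + x i)) := by
    ext u
    simp only [box, Finset.mem_image, Fintype.mem_piFinset]
    constructor
    · rintro ⟨a, ha, rfl⟩ i
      exact ⟨a i, ha i, rfl⟩
    · intro h
      choose a ha hb using h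
      exact ⟨a, ha, funext hb⟩
  have c1 : ∀ i, (K.image (· + x i)).card = K.card := fun i =>
    Finset.card_image_of_injective _ (add_left_injective _)
  have b1 := card_pi_sdiff_le d (fun i => K.image (· + x i)) (fun _ => K) K.card c1
  have b2 := card_pi_sdiff_le d (fun _ => K) (fun i => K.image (· + x i)) K.card (fun _ => rfl)
  have hc : ∀ A B : Finset G, ((symmDiff B A).card : ℝ) = (B \ A).card + (A \ B).card := by
    intro A B
    rw [symmDiff_def, Finset.sup_eq_union, Finset.card_union_of_disjoint disjoint_sdiff_sdiff]
    push_cast; rfl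
  have hc2 : ∀ A B : Finset (Fin d → G),
      ((symmDiff B A).card : ℝ) = (B \ A).card + (A \ B).card := by
    intro A B
    rw [symmDiff_def, Finset.sup_eq_union, Finset.card_union_of_disjoint disjoint_sdiff_sdiff]
    push_cast; rfl
  rw [e, hc2, card_box, ← Finset.sum_div]
  simp only [hc, Finset.sum_add_distrib]
  push_cast
  rw [div_le_div_iff₀ (by positivity) hpos]
  simp only [box] at *
  linarith

lemma sum_box_succ (d : ℕ) (K : Finset G) (F : (Fin (d + 1) → G) → ℝ) :
    ∑ u ∈ box (d + 1) K, F u = ∑ a ∈ K, ∑ u ∈ box d K, F (Fin.cons a u) := by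
  rw [← Finset.sum_product']
  symm
  refine Finset.sum_bij' (fun p _ => Fin.cons p.1 p.2) (fun u _ => (u 0, Fin.tail u)) ?_ ?_ ?_ ?_ ?_
  · rintro ⟨a, u⟩ h
    simp only [box, Finset.mem_product, Fintype.mem_piFinset] at h ⊢
    intro i
    refine Fin.cases ?_ (fun i => ?_) i
    · simpa using h.1
    · simpa using h.2 i
  · intro u h
    simp only [box, Finset.mem_product, Fintype.mem_piFinset] at h ⊢
    exact ⟨h 0, fun i => h i.succ⟩
  · rintro ⟨a, u⟩ h; simp
  · intro u h; simp
  · intro p h; rfl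

lemma avg_box_succ (d : ℕ) (K : Finset G) (F : (Fin (d + 1) → G) → ℝ) :
    avg (box (d + 1) K) F = avg K (fun a => avg (box d K) (fun u => F (Fin.cons a u))) := by
  simp only [avg, smul_eq_mul, sum_box_succ, card_box, Finset.mul_sum]
  refine Finset.sum_congr rfl fun _ _ => Finset.sum_congr rfl fun _ _ => ?_
  push_cast
  rw [pow_succ, mul_inv]; ring

end folner

end HKaux

namespace HKaux

section gcs
variable {Γ W : Type*} [AddCommGroup Γ] [DecidableEq Γ] [MeasurableSpace W]

/-- A measure preserving action. -/
structure Act (R : Γ → W → W) (m : Measure W) : Prop where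
  zero : ∀ w, R 0 w = w
  add : ∀ g h w, R (g + h) w = R g (R h w)
  mp : ∀ g, MeasurePreserving (R g) m m

/-- The cube integral for a family of functions. -/
noncomputable def cubeInt (R : Γ → W → W) (m : Measure W) (d : ℕ)
    (F : Finset (Fin d) → W → ℝ) (u : Fin d → Γ) : ℝ :=
  ∫ w, ∏ s, F s (R (∑ i ∈ s, u i) w) ∂m

lemma bint {m : Measure W} [IsProbabilityMeasure m] {f : W → ℝ} (hf : Measurable f) {C : ℝ}
    (hC : ∀ w, |f w| ≤ C) : Integrable f m :=
  Integrable.of_bound hf.aestronglyMeasurable C (Eventually.of_forall hC)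

lemma abs_prod_le_one {ι : Type*} (s : Finset ι) (a : ι → ℝ) (h : ∀ i ∈ s, |a i| ≤ 1) :
    |∏ i ∈ s, a i| ≤ 1 := by
  rw [Finset.abs_prod]
  exact Finset.prod_le_one (fun _ _ => abs_nonneg _) h

lemma abs_integral_le_one {m : Measure W} [IsProbabilityMeasure m] {f : W → ℝ}
    (h : ∀ w, |f w| ≤ 1) : |∫ w, f w ∂m| ≤ 1 := by
  have := norm_integral_le_of_norm_le_const (μ := m) (f := f) (C := 1) (Eventually.of_forall h)
  simpa using this

lemma sq_integral_le {m : Measure W} [IsProbabilityMeasure m] {f : W → ℝ} (hf : Measurable f)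
    {C : ℝ} (hC : ∀ w, |f w| ≤ C) : (∫ w, f w ∂m) ^ 2 ≤ ∫ w, f w ^ 2 ∂m := by
  set c := ∫ w, f w ∂m with hc
  have hi := bint (m := m) hf hC
  have hi2 : Integrable (fun w => f w ^ 2) m := by
    refine bint (C := C ^ 2) (hf.pow_const 2) fun w => ?_
    rw [abs_pow]; exact pow_le_pow_left₀ (abs_nonneg _) (hC w) 2
  have h : 0 ≤ ∫ w, (f w - c) ^ 2 ∂m := integral_nonneg fun w => sq_nonneg _
  have e : ∫ w, (f w - c) ^ 2 ∂m = ∫ w, f w ^ 2 ∂m - c ^ 2 := by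
    have : ∀ w, (f w - c) ^ 2 = f w ^ 2 - 2 * c * f w + c ^ 2 := fun w => by ring
    simp only [this]
    have hi3 : Integrable (fun w => 2 * c * f w) m := hi.const_mul _
    have hi4 : Integrable (fun w => f w ^ 2 - 2 * c * f w) m := hi2.sub hi3
    rw [integral_add hi4 (integrable_const _), integral_sub hi2 hi3, integral_const_mul, ← hc]
    simp; ring
  linarith

lemma abs_mul_le_one {a b : ℝ} (ha : |a| ≤ 1) (hb : |b| ≤ 1) : |a * b| ≤ 1 := by
  rw [abs_mul]; exact mul_le_one₀ ha (abs_nonneg _) hb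

variable {R : Γ → W → W} {m : Measure W} [IsProbabilityMeasure m]

lemma Act.integral_comp (h : Act R m) (g : Γ) {f : W → ℝ} (hf : Measurable f) :
    ∫ w, f (R g w) ∂m = ∫ w, f w ∂m := by
  have := integral_map (μ := m) (h.mp g).measurable.aemeasurable (f := f)
    hf.aestronglyMeasurable
  rw [(h.mp g).map_eq] at this
  exact this.symm

lemma cs_step (h : Act R m) {K : Finset Γ} (hK : K.Nonempty) {A H : W → ℝ} (hA : Measurable A)
    (hH : Measurable H) (hA1 : ∀ w, |A w| ≤ 1) (hH1 : ∀ w, |H w| ≤ 1) :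
    (avg K (fun a => ∫ w, A w * H (R a w) ∂m)) ^ 2 ≤
      avg K (fun b => avg K (fun a => ∫ w, A w * A (R (a - b) w) ∂m)) := by
  have hR : ∀ g, Measurable (R g) := fun g => (h.mp g).measurable
  have hAR : ∀ g, Measurable (fun w => A (R g w)) := fun g => hA.comp (hR g)
  have e1 : ∀ a, ∫ w, A w * H (R a w) ∂m = ∫ w, A (R (-a) w) * H w ∂m := by
    intro a
    rw [← h.integral_comp a (f := fun w => A (R (-a) w) * H w) ((hAR (-a)).mul hH)]
    simp [← h.add, h.zero]
  have e2 : ∀ a b, ∫ w, A (R (-a) w) * A (R (-b) w) ∂m = ∫ w, A w * A (R (a - b) w) ∂m := by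
    intro a b
    rw [← h.integral_comp a (f := fun w => A (R (-a) w) * A (R (-b) w))
      ((hAR (-a)).mul (hAR (-b)))]
    simp [← h.add, h.zero, sub_eq_neg_add]
  set B : W → ℝ := fun w => avg K (fun a => A (R (-a) w)) with hB
  have hBm : Measurable B := by
    simp only [hB, avg, smul_eq_mul]
    exact (Finset.measurable_fun_sum _ (fun a _ => hAR (-a))).const_mul _
  have hB1 : ∀ w, |B w| ≤ 1 := fun w => abs_avg_le_const hK (fun a _ => hA1 _)
  have e3 : avg K (fun a => ∫ w, A w * H (R a w) ∂m) = ∫ w, B w * H w ∂m := by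
    simp only [e1]
    rw [avg_integral]
    · refine integral_congr_ae (Eventually.of_forall fun w => ?_)
      simp only [hB, avg, smul_eq_mul, Finset.mul_sum, Finset.sum_mul, mul_assoc]
    · exact fun a => bint ((hAR (-a)).mul hH) (fun w => abs_mul_le_one (hA1 _) (hH1 _))
  have e4 : avg K (fun b => avg K (fun a => ∫ w, A w * A (R (a - b) w) ∂m)) = ∫ w, B w ^ 2 ∂m := by
    simp only [← e2]
    have hi : ∀ a b, Integrable (fun w => A (R (-a) w) * A (R (-b) w)) m := fun a b =>
      bint ((hAR (-a)).mul (hAR (-b))) (fun w => abs_mul_le_one (hA1 _) (hA1 _))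
    have : ∀ b, avg K (fun a => ∫ w, A (R (-a) w) * A (R (-b) w) ∂m)
        = ∫ w, B w * A (R (-b) w) ∂m := by
      intro b
      rw [avg_integral _ _ _ (fun a => hi a b)]
      refine integral_congr_ae (Eventually.of_forall fun w => ?_)
      simp only [hB, avg, smul_eq_mul, Finset.mul_sum, Finset.sum_mul, mul_assoc]
    simp only [this]
    rw [avg_integral]
    · refine integral_congr_ae (Eventually.of_forall fun w => ?_)
      simp only [pow_two]
      conv_rhs => rw [hB]
      simp only [avg, smul_eq_mul, Finset.mul_sum]
      refine Finset.sum_congr rfl fun b _ => ?_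
      simp only [hB, avg, smul_eq_mul, Finset.mul_sum, Finset.sum_mul]
      refine Finset.sum_congr rfl fun b _ => ?_
      ring
    · exact fun b => bint (hBm.mul (hAR (-b))) (fun w => abs_mul_le_one (hB1 _) (hA1 _))
  rw [e3, e4]
  have hBH : ∀ w, |B w * H w| ≤ 1 := fun w => abs_mul_le_one (hB1 _) (hH1 _)
  refine (sq_integral_le (f := fun w => B w * H w) (hBm.mul hH) hBH).trans (integral_mono ?_ ?_ fun w => ?_)
  · refine bint (C := 1) ((hBm.mul hH).pow_const 2) fun w => ?_
    rw [abs_pow]; exact pow_le_one₀ (abs_nonneg _) (hBH w)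
  · refine bint (C := 1) (hBm.pow_const 2) fun w => ?_
    rw [abs_pow]; exact pow_le_one₀ (abs_nonneg _) (hB1 w)
  · simp only [Pi.mul_apply, mul_pow]
    have := (sq_le_one_iff_abs_le_one (H w)).2 (hH1 w)
    nlinarith [sq_nonneg (B w)]

lemma prod_finset_succ (d : ℕ) (F : Finset (Fin (d + 1)) → ℝ) :
    ∏ s, F s = (∏ s : Finset (Fin d), F (s.map (Fin.succEmb d))) *
      ∏ s : Finset (Fin d), F (insert 0 (s.map (Fin.succEmb d))) := by
  have h0 : (0 : Fin (d + 1)) ∉ (Finset.univ : Finset (Fin d)).map (Fin.succEmb d) := by simp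
  have h1 : (Finset.univ : Finset (Fin (d + 1))) =
      insert 0 ((Finset.univ : Finset (Fin d)).map (Fin.succEmb d)) := by
    ext i; refine Fin.cases ?_ (fun i => ?_) i <;> simp
  rw [← Finset.powerset_univ, h1, Finset.prod_powerset_insert h0]
  have h2 : ((Finset.univ : Finset (Fin d)).map (Fin.succEmb d)).powerset =
      (Finset.univ : Finset (Finset (Fin d))).map (Finset.mapEmbedding (Fin.succEmb d)).toEmbedding := by
    ext t
    simp only [Finset.mem_powerset, Finset.mem_map, Finset.mem_univ, true_and]
    constructor
    · intro ht
      obtain ⟨u, -, rfl⟩ := Finset.subset_map_iff.1 ht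
      exact ⟨u, rfl⟩
    · rintro ⟨u, rfl⟩
      exact Finset.map_subset_map.2 (Finset.subset_univ _)
  rw [h2, Finset.prod_map, Finset.prod_map]
  rfl

lemma prod_cube_cons (h : Act R m) (d : ℕ) (F : Finset (Fin (d + 1)) → W → ℝ) (a : Γ)
    (u : Fin d → Γ) (w : W) :
    ∏ s, F s (R (∑ i ∈ s, (Fin.cons a u : Fin (d + 1) → Γ) i) w) =
      (∏ s : Finset (Fin d), F (s.map (Fin.succEmb d)) (R (∑ i ∈ s, u i) w)) *
      ∏ s : Finset (Fin d), F (insert 0 (s.map (Fin.succEmb d))) (R (∑ i ∈ s, u i) (R a w)) := by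
  rw [prod_finset_succ]
  congr 1
  · refine Finset.prod_congr rfl fun s _ => ?_
    simp
  · refine Finset.prod_congr rfl fun s _ => ?_
    rw [Finset.sum_insert (by simp), ← h.add, add_comm (∑ i ∈ s, u i) a]
    simp

lemma act_comm (h : Act R m) (a b : Γ) (w : W) : R a (R b w) = R b (R a w) := by
  rw [← h.add, add_comm, h.add]

theorem gcs (h : Act R m) {K : Finset Γ} (hK : K.Nonempty) : ∀ (d : ℕ)
    (F : Finset (Fin d) → W → ℝ), (∀ s, Measurable (F s)) → (∀ s w, |F s w| ≤ 1) →
    avg (box d K) (fun u => cubeInt R m d F u) ^ (2 ^ d) ≤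
      avg (box d K) (fun v => avg (box d K) (fun u => cubeInt R m d (fun _ => F ∅) (u - v))) := by
  intro d
  have hR : ∀ g, Measurable (R g) := fun g => (h.mp g).measurable
  induction d with
  | zero =>
    intro F hF hF1
    have : ∀ u v : Fin 0 → Γ, cubeInt R m 0 (fun _ => F ∅) (u - v) = ∫ w, F ∅ w ∂m := by
      intro u v
      have hd : (default : Finset (Fin 0)) = ∅ := Subsingleton.elim _ _
      simp [cubeInt, Finset.univ_unique, h.zero, hd]
    have h2 : ∀ u : Fin 0 → Γ, cubeInt R m 0 F u = ∫ w, F ∅ w ∂m := by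
      intro u
      have hd : (default : Finset (Fin 0)) = ∅ := Subsingleton.elim _ _
      simp [cubeInt, Finset.univ_unique, h.zero, hd]
    simp only [this, h2, avg_const (box_nonempty 0 hK)]
    simp
  | succ d ih =>
    intro F hF hF1
    set A : (Fin d → Γ) → W → ℝ := fun u w =>
      ∏ s : Finset (Fin d), F (s.map (Fin.succEmb d)) (R (∑ i ∈ s, u i) w) with hA
    set H : (Fin d → Γ) → W → ℝ := fun u w =>
      ∏ s : Finset (Fin d), F (insert 0 (s.map (Fin.succEmb d))) (R (∑ i ∈ s, u i) w) with hH
    have hAm : ∀ u, Measurable (A u) := fun u =>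
      Finset.measurable_fun_prod _ (fun s _ => (hF _).comp (hR _))
    have hHm : ∀ u, Measurable (H u) := fun u =>
      Finset.measurable_fun_prod _ (fun s _ => (hF _).comp (hR _))
    have hA1 : ∀ u w, |A u w| ≤ 1 := fun u w => abs_prod_le_one _ _ (fun s _ => hF1 _ _)
    have hH1 : ∀ u w, |H u w| ≤ 1 := fun u w => abs_prod_le_one _ _ (fun s _ => hF1 _ _)
    -- derivative family
    set D : Γ → Finset (Fin d) → W → ℝ := fun c s w =>
      F (s.map (Fin.succEmb d)) w * F (s.map (Fin.succEmb d)) (R c w) with hD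
    have hDm : ∀ c s, Measurable (D c s) := fun c s => (hF _).mul ((hF _).comp (hR _))
    have hD1 : ∀ c s w, |D c s w| ≤ 1 := fun c s w => abs_mul_le_one (hF1 _ _) (hF1 _ _)
    have k1 : ∀ a u, cubeInt R m (d + 1) F (Fin.cons a u) = ∫ w, A u w * H u (R a w) ∂m := by
      intro a u
      simp only [cubeInt, prod_cube_cons h]
      rfl
    have k2 : ∀ c u, ∫ w, A u w * A u (R c w) ∂m = cubeInt R m d (D c) u := by
      intro c u
      simp only [cubeInt, hA, hD, ← Finset.prod_mul_distrib]
      refine integral_congr_ae (Eventually.of_forall fun w => ?_)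
      refine Finset.prod_congr rfl fun s _ => ?_
      rw [act_comm h c]
    have k3 : ∀ a b u v, cubeInt R m (d + 1) (fun _ => F ∅) (Fin.cons a u - Fin.cons b v) =
        cubeInt R m d (fun _ => D (a - b) ∅) (u - v) := by
      intro a b u v
      have : (Fin.cons a u - Fin.cons b v : Fin (d + 1) → Γ) = Fin.cons (a - b) (u - v) := by
        ext i; refine Fin.cases ?_ (fun i => ?_) i <;> simp
      rw [this]
      simp only [cubeInt, prod_cube_cons h, hD, Finset.map_empty, ← Finset.prod_mul_distrib]
      refine integral_congr_ae (Eventually.of_forall fun w => ?_)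
      refine Finset.prod_congr rfl fun s _ => ?_
      rw [act_comm h (a - b)]
    have s1 : avg (box (d + 1) K) (fun u => cubeInt R m (d + 1) F u) ^ 2 ≤
        avg K (fun b => avg K (fun a => avg (box d K) (fun u => cubeInt R m d (D (a - b)) u))) := by
      rw [avg_box_succ]
      simp only [k1]
      rw [avg_comm]
      refine (avg_pow_le (box_nonempty d hK) _ even_two).trans ?_
      refine (avg_mono (fun u _ => cs_step h hK (hAm u) (hHm u) (hA1 u) (hH1 u))).trans_eq ?_
      simp only [k2]
      rw [avg_comm]
      exact avg_congr fun b _ => avg_comm _ _ _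
    calc _ = (avg (box (d + 1) K) (fun u => cubeInt R m (d + 1) F u) ^ 2) ^ (2 ^ d) := by
          rw [← pow_mul]; congr 1; ring
      _ ≤ (avg K (fun b => avg K (fun a =>
            avg (box d K) (fun u => cubeInt R m d (D (a - b)) u)))) ^ (2 ^ d) :=
          pow_le_pow_left₀ (sq_nonneg _) s1 _
      _ ≤ avg K (fun b => avg K (fun a =>
            (avg (box d K) (fun u => cubeInt R m d (D (a - b)) u)) ^ (2 ^ d))) :=
          (avg_pow_two_pow_le hK _ d).trans (avg_mono fun b _ => avg_pow_two_pow_le hK _ d)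
      _ ≤ avg K (fun b => avg K (fun a => avg (box d K) (fun v => avg (box d K)
            (fun u => cubeInt R m d (fun _ => D (a - b) ∅) (u - v))))) :=
          avg_mono fun b _ => avg_mono fun a _ => ih (D (a - b)) (hDm _) (hD1 _)
      _ = _ := by
          simp only [avg_box_succ d K, k3]
          exact avg_congr fun b _ => avg_comm _ _ _

end gcs

end HKaux

namespace HKaux

section nullness
variable {Γ W : Type*} [AddCommGroup Γ] [DecidableEq Γ] [MeasurableSpace W]
variable {R : Γ → W → W} {m : Measure W} [IsProbabilityMeasure m]

lemma exists_box_small [Countable Γ] (h : Act R m) {d : ℕ} (hd : 0 < d) {f : W → ℝ}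
    (hnull : HKSeminormZero d R m f) {ε : ℝ} (hε : 0 < ε) :
    ∃ B : Finset (Fin d → Γ), B.Nonempty ∧ ∀ F : Finset (Fin d) → W → ℝ,
      (∀ s, Measurable (F s)) → (∀ s w, |F s w| ≤ 1) → F ∅ = f →
      |avg B (fun u => cubeInt R m d F u)| ≤ ε := by
  obtain ⟨Φ, hΦ⟩ := exists_folner Γ
  set N : (Fin d → Γ) → ℝ := fun u => cubeInt R m d (fun _ => f) u with hN
  have hmax : ∀ n, ∃ v ∈ box d (Φ n), ∀ v' ∈ box d (Φ n),
      |avg (box d (Φ n)) (fun u => N (u - v'))| ≤ |avg (box d (Φ n)) (fun u => N (u - v))| :=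
    fun n => Finset.exists_max_image _ _ (box_nonempty d (hΦ.1 n))
  choose v hv hvmax using hmax
  have hF := isFolner_translate (isFolner_box d hΦ) v
  have hlim := hnull _ hF
  have e : ∀ n, (((((box d (Φ n)).image (· - v n)).card : ℕ) : ℝ)⁻¹) •
      ∑ g ∈ (box d (Φ n)).image (· - v n), ∫ x, gowersProd d R f g x ∂m =
      avg (box d (Φ n)) (fun u => N (u - v n)) := by
    intro n
    have inj : Function.Injective (fun g : Fin d → Γ => g - v n) := sub_left_injective
    rw [Finset.card_image_of_injective _ inj, Finset.sum_image inj.injOn]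
    rfl
  simp only [e] at hlim
  have hev := (Metric.tendsto_nhds.1 hlim) (ε ^ (2 ^ d)) (by positivity)
  obtain ⟨n, hn⟩ := hev.exists
  rw [Real.dist_eq, sub_zero] at hn
  refine ⟨box d (Φ n), box_nonempty d (hΦ.1 n), fun F hFm hF1 hF0 => ?_⟩
  have g := gcs h (hΦ.1 n) d F hFm hF1
  rw [hF0] at g
  have g2 : avg (box d (Φ n)) (fun v => avg (box d (Φ n)) (fun u => N (u - v))) ≤ ε ^ (2 ^ d) :=
    (le_abs_self _).trans ((abs_avg_le_const (box_nonempty d (hΦ.1 n))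
      (fun v' hv' => hvmax n v' hv')).trans hn.le)
  have hev2 : Even (2 ^ d) := Nat.even_pow.2 ⟨even_two, hd.ne'⟩
  have g3 := g.trans g2
  rw [← hev2.pow_abs] at g3
  exact (pow_le_pow_iff_left₀ (abs_nonneg _) hε.le (by positivity)).1 g3

lemma cubeInt_le_one {d : ℕ} (F : Finset (Fin d) → W → ℝ) (hF : ∀ s w, |F s w| ≤ 1)
    (u : Fin d → Γ) : |cubeInt R m d F u| ≤ 1 :=
  abs_integral_le_one fun _ => abs_prod_le_one _ _ fun _ _ => hF _ _

lemma uniform_small [Countable Γ] (h : Act R m) {d : ℕ} (hd : 0 < d) {f : W → ℝ}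
    (hnull : HKSeminormZero d R m f) {Ψ : ℕ → Finset (Fin d → Γ)} (hΨ : IsFolner Ψ)
    {ε : ℝ} (hε : 0 < ε) :
    ∀ᶠ N in atTop, ∀ F : Finset (Fin d) → W → ℝ,
      (∀ s, Measurable (F s)) → (∀ s w, |F s w| ≤ 1) → F ∅ = f →
      |avg (Ψ N) (fun u => cubeInt R m d F u)| ≤ ε := by
  obtain ⟨B, hB, hBs⟩ := exists_box_small h hd hnull (half_pos hε)
  have hlim : Tendsto (fun N => avg B (fun x =>
      ((symmDiff ((Ψ N).image (· + x)) (Ψ N)).card : ℝ) / (Ψ N).card * 1)) atTop (nhds 0) := by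
    have := (tendsto_finsetSum B (fun x _ => (hΨ.2 x).mul_const 1)).const_mul ((B.card : ℝ)⁻¹)
    simpa [avg] using this
  filter_upwards [hlim.eventually (gt_mem_nhds (half_pos hε))] with N hN F hFm hF1 hF0
  set a : (Fin d → Γ) → ℝ := fun u => cubeInt R m d F u with ha
  have ha1 : ∀ u, |a u| ≤ 1 := cubeInt_le_one F hF1
  have hΨN := hΨ.1 N
  have s1 : |avg B (fun x => avg (Ψ N) (fun g => a (g + x))) - avg (Ψ N) a| ≤ ε / 2 := by
    have : avg B (fun x => avg (Ψ N) (fun g => a (g + x))) - avg (Ψ N) a =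
        avg B (fun x => avg (Ψ N) (fun g => a (g + x)) - avg (Ψ N) a) := by
      rw [avg_sub, avg_const hB]
    rw [this]
    exact (abs_avg_le _ _).trans ((avg_mono fun x _ => avg_shift (Ψ N) x a ha1).trans hN.le)
  have s2 : |avg B (fun x => avg (Ψ N) (fun g => a (g + x)))| ≤ ε / 2 := by
    rw [avg_comm]
    refine abs_avg_le_const hΨN fun g _ => ?_
    have := hBs (fun s w => F s (R (∑ i ∈ s, g i) w))
      (fun s => (hFm s).comp (h.mp _).measurable) (fun s w => hF1 _ _)
      (by simp [h.zero, hF0])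
    refine le_of_eq_of_le ?_ this
    congr 1
    refine avg_congr fun x _ => ?_
    simp only [ha, cubeInt, Pi.add_apply, Finset.sum_add_distrib, h.add]
  rw [abs_le] at *
  constructor <;> linarith [s1.1, s1.2, s2.1, s2.2]

lemma prod_erase_empty {d : ℕ} (a : Finset (Fin d) → ℝ) :
    ∏ s, a s = a ∅ * ∏ s ∈ Finset.univ.erase ∅, a s :=
  (Finset.mul_prod_erase _ _ (Finset.mem_univ _)).symm

lemma null_mul [Countable Γ] (h : Act R m) {d : ℕ} (hd : 0 < d) {f D φ : W → ℝ}
    (hf : Measurable f) (hDm : Measurable D) (hφ : Measurable φ)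
    (hf1 : ∀ w, |f w| ≤ 1) (hD1 : ∀ w, |D w| ≤ 1) (hφ1 : ∀ w, |φ w| ≤ 1)
    (hnull : HKSeminormZero d R m f) {Φ : ℕ → Finset (Fin d → Γ)} (hΦ : IsFolner Φ)
    {l : Filter ℕ} [l.NeBot] (hl : l ≤ atTop)
    (hD : ∀ q : W → ℝ, Measurable q → (∀ w, |q w| ≤ 1) →
      Tendsto (fun M => avg (Φ M) (fun g => ∫ w, q w *
        ∏ s ∈ Finset.univ.erase ∅, φ (R (∑ i ∈ s, g i) w) ∂m)) l (nhds (∫ w, q w * D w ∂m))) :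
    HKSeminormZero d R m (fun w => f w * D w) := by
  intro Ψ hΨ
  have hR : ∀ g, Measurable (R g) := fun g => (h.mp g).measurable
  set E : W → ℝ := fun w => f w * D w with hE
  have hEm : Measurable E := hf.mul hDm
  have hE1 : ∀ w, |E w| ≤ 1 := fun w => abs_mul_le_one (hf1 w) (hD1 w)
  set q : (Fin d → Γ) → W → ℝ := fun u w =>
    f w * ∏ s ∈ Finset.univ.erase ∅, E (R (∑ i ∈ s, u i) w) with hq
  have hqm : ∀ u, Measurable (q u) := fun u =>
    hf.mul (Finset.measurable_fun_prod _ (fun s _ => hEm.comp (hR _)))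
  have hq1 : ∀ u w, |q u w| ≤ 1 := fun u w =>
    abs_mul_le_one (hf1 w) (abs_prod_le_one _ _ fun s _ => hE1 _)
  set c : (Fin d → Γ) → (Fin d → Γ) → ℝ := fun u g =>
    ∫ w, q u w * ∏ s ∈ Finset.univ.erase ∅, φ (R (∑ i ∈ s, g i) w) ∂m with hc
  have hc1 : ∀ u g, |c u g| ≤ 1 := fun u g => abs_integral_le_one fun w =>
    abs_mul_le_one (hq1 u w) (abs_prod_le_one _ _ fun s _ => hφ1 _)
  have e0 : ∀ u, ∫ x, gowersProd d R E u x ∂m = ∫ w, q u w * D w ∂m := by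
    intro u
    refine integral_congr_ae (Eventually.of_forall fun w => ?_)
    simp only [gowersProd, prod_erase_empty, Finset.sum_empty, h.zero, hq]
    simp only [hE]; ring
  change Tendsto (fun N => avg (Ψ N) (fun u => ∫ x, gowersProd d R E u x ∂m)) atTop (nhds 0)
  simp only [e0]
  rw [Metric.tendsto_nhds]
  intro ε hε
  filter_upwards [uniform_small h hd hnull hΨ (half_pos hε)] with N hN
  rw [Real.dist_eq, sub_zero]
  refine lt_of_le_of_lt ?_ (half_lt_self hε)
  -- convergence along `l`
  have t1 : Tendsto (fun M => avg (Ψ N) (fun u => avg (Φ M) (fun g => c u (g + u)))) l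
      (nhds (avg (Ψ N) (fun u => ∫ w, q u w * D w ∂m))) := by
    have t2 : ∀ u, Tendsto (fun M => avg (Φ M) (fun g => c u (g + u))) l
        (nhds (∫ w, q u w * D w ∂m)) := by
      intro u
      have a1 := hD (q u) (hqm u) (hq1 u)
      have a2 := (avg_shift_tendsto hΦ u (c u) (hc1 u)).mono_left hl
      have a3 := a2.add a1
      simpa [hc] using a3
    exact (tendsto_finsetSum (Ψ N) (fun u _ => t2 u)).const_smul _
  refine le_of_tendsto t1.abs (Eventually.of_forall fun M => ?_)
  rw [avg_comm]
  refine abs_avg_le_const (hΦ.1 M) fun g _ => ?_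
  have := hN (fun s => if s = ∅ then f else fun w => E w * φ (R (∑ i ∈ s, g i) w)) ?_ ?_ (by simp)
  · refine le_of_eq_of_le ?_ this
    congr 1
    refine avg_congr fun u _ => ?_
    simp only [hc, cubeInt]
    refine integral_congr_ae (Eventually.of_forall fun w => ?_)
    simp only [prod_erase_empty, Finset.sum_empty, h.zero, hq, if_true, mul_assoc,
      ← Finset.prod_mul_distrib]
    congr 1
    refine Finset.prod_congr rfl fun s hs => ?_
    simp only [if_neg (Finset.ne_of_mem_erase hs), Pi.add_apply, Finset.sum_add_distrib, h.add]
  · intro s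
    by_cases hs : s = ∅
    · simpa [hs] using hf
    · simp only [if_neg hs]; exact hEm.mul (hφ.comp (hR _))
  · intro s w
    by_cases hs : s = ∅
    · simpa [hs] using hf1 w
    · simp only [if_neg hs]; exact abs_mul_le_one (hE1 _) (hφ1 _)

lemma clip_le (x : ℝ) : |max (-1) (min 1 x)| ≤ 1 := by
  rw [abs_le]; exact ⟨le_max_left _ _, max_le (by norm_num) (min_le_left _ _)⟩

lemma clip_eq {x : ℝ} (h1 : -1 ≤ x) (h2 : x ≤ 1) : max (-1) (min 1 x) = x := by
  rw [min_eq_right h2, max_eq_right h1]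

lemma exists_weak_limit (D : ℕ → W → ℝ) (hD : ∀ n, Measurable (D n)) (hD1 : ∀ n w, |D n w| ≤ 1)
    (U : Ultrafilter ℕ) : ∃ D' : W → ℝ, Measurable D' ∧ (∀ w, |D' w| ≤ 1) ∧
      ∀ q : W → ℝ, Measurable q → (∀ w, |q w| ≤ 1) →
        Tendsto (fun n => ∫ w, q w * D n w ∂m) U (nhds (∫ w, q w * D' w ∂m)) := by
  have hmem : ∀ q : W → ℝ, Measurable q → (∀ w, |q w| ≤ 1) → MemLp q 2 m := fun q hq h1 =>
    MemLp.of_bound hq.aestronglyMeasurable 1 (Eventually.of_forall h1)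
  set x : ℕ → Lp ℝ 2 m := fun n => (hmem _ (hD n) (hD1 n)).toLp with hx
  have hxn : ∀ n, ‖x n‖ ≤ 1 := by
    intro n
    have := Lp.norm_le_of_ae_bound (f := x n) (C := 1) zero_le_one (by
      filter_upwards [(hmem _ (hD n) (hD1 n)).coeFn_toLp] with w hw
      rw [hw]; exact hD1 n w)
    simpa [measureUnivNNReal] using this
  have hcomp := WeakDual.isCompact_closedBall (𝕜 := ℝ) (E := Lp ℝ 2 m) 0 1
  set y : ℕ → WeakDual ℝ (Lp ℝ 2 m) := fun n =>
    StrongDual.toWeakDual (InnerProductSpace.toDual ℝ _ (x n)) with hy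
  obtain ⟨L, -, hL⟩ := hcomp.ultrafilter_le_nhds (U.map y) (by
    rw [le_principal_iff]
    refine Filter.mem_map.2 (Filter.univ_mem' fun n => ?_)
    simp only [Set.mem_preimage, mem_closedBall_zero_iff, hy]
    have : ‖(InnerProductSpace.toDual ℝ (Lp ℝ 2 m)) (x n)‖ ≤ 1 := by
      rw [LinearIsometryEquiv.norm_map]; exact hxn n
    exact this)
  have hLt : Tendsto y U (nhds L) := hL
  set D0 : Lp ℝ 2 m := (InnerProductSpace.toDual ℝ _).symm (WeakDual.toStrongDual L) with hD0
  have key : ∀ q : W → ℝ, Measurable q → (∀ w, |q w| ≤ 1) →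
      Tendsto (fun n => ∫ w, q w * D n w ∂m) U (nhds (∫ w, q w * D0 w ∂m)) := by
    intro q hq hq1
    have t := ((WeakDual.eval_continuous (𝕜 := ℝ) (hmem q hq hq1).toLp).tendsto L).comp hLt
    have e1 : ∀ n, y n (hmem q hq hq1).toLp = ∫ w, q w * D n w ∂m := by
      intro n
      change inner ℝ (x n) ((hmem q hq hq1).toLp) = _
      rw [L2.inner_def]
      refine integral_congr_ae ?_
      filter_upwards [(hmem _ (hD n) (hD1 n)).coeFn_toLp, (hmem q hq hq1).coeFn_toLp] with w h1 h2
      simp [hx, h1, h2]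
    have e2 : L (hmem q hq hq1).toLp = ∫ w, q w * D0 w ∂m := by
      have : L (hmem q hq hq1).toLp = inner ℝ D0 ((hmem q hq hq1).toLp) := by
        rw [hD0, InnerProductSpace.toDual_symm_apply]; rfl
      rw [this, L2.inner_def]
      refine integral_congr_ae ?_
      filter_upwards [(hmem q hq hq1).coeFn_toLp] with w h2
      simp [h2]
    simp only [Function.comp_def, e1, e2] at t
    exact t
  have hi0 : Integrable (D0 : W → ℝ) m := (Lp.memLp D0).integrable (by norm_num)
  have hset : ∀ s, MeasurableSet s →
      Tendsto (fun n => ∫ w in s, D n w ∂m) U (nhds (∫ w in s, D0 w ∂m)) := by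
    intro s hs
    have := key (s.indicator 1) (measurable_one.indicator hs) (fun w => by
      by_cases hw : w ∈ s <;> simp [hw])
    have e : ∀ g : W → ℝ, ∫ w, s.indicator 1 w * g w ∂m = ∫ w in s, g w ∂m := by
      intro g
      rw [← integral_indicator hs]
      refine integral_congr_ae (Eventually.of_forall fun w => ?_)
      by_cases hw : w ∈ s <;> simp [hw]
    simpa only [e] using this
  have hup : (D0 : W → ℝ) ≤ᵐ[m] fun _ => 1 := by
    refine ae_le_of_forall_setIntegral_le hi0 (integrable_const _) fun s hs _ => ?_
    refine le_of_tendsto (hset s hs) (Eventually.of_forall fun n => ?_)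
    exact integral_mono (bint (hD n) (hD1 n)).integrableOn (integrable_const _)
      fun w => (abs_le.1 (hD1 n w)).2
  have hlo : (fun _ => (-1 : ℝ)) ≤ᵐ[m] (D0 : W → ℝ) := by
    refine ae_le_of_forall_setIntegral_le (integrable_const _) hi0 fun s hs _ => ?_
    refine ge_of_tendsto (hset s hs) (Eventually.of_forall fun n => ?_)
    exact integral_mono (integrable_const _) (bint (hD n) (hD1 n)).integrableOn
      fun w => (abs_le.1 (hD1 n w)).1
  refine ⟨fun w => max (-1) (min 1 (D0 w)), ?_, fun w => clip_le _, fun q hq hq1 => ?_⟩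
  · exact measurable_const.max (measurable_const.min (Lp.stronglyMeasurable D0).measurable)
  · have : ∫ w, q w * max (-1) (min 1 (D0 w)) ∂m = ∫ w, q w * D0 w ∂m := by
      refine integral_congr_ae ?_
      filter_upwards [hup, hlo] with w h1 h2
      rw [clip_eq h2 h1]
    rw [this]
    exact key q hq hq1

end nullness

end HKaux

namespace HKaux

section final

lemma integral_map_real {X Y : Type*} {mZ : MeasurableSpace X} {mY : MeasurableSpace Y}
    (ν : Measure Y) (π : Y → X) (hπm : Measurable π) (g : X → ℝ) (hg : Measurable g) :
    ∫ x, g x ∂(Measure.map π ν) = ∫ y, g (π y) ∂ν :=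
  integral_map hπm.aemeasurable hg.aestronglyMeasurable

lemma integral_factor {X Y : Type*} {mZ mX : MeasurableSpace X} {mY : MeasurableSpace Y}
    (hle : mZ ≤ mX) (μ : @Measure X mX) (ν : Measure Y) (π : Y → X)
    (hπm : @Measurable Y X mY mZ π)
    (hπmp : ∀ s : Set X, MeasurableSet[mZ] s → ν (π ⁻¹' s) = μ s)
    (g : X → ℝ) (hg : Measurable[mZ] g) : ∫ x, g x ∂μ = ∫ y, g (π y) ∂ν := by
  have hmap : @Measure.map Y X mY mZ π ν = μ.trim hle := by
    refine @Measure.ext X mZ _ _ fun s hs => ?_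
    rw [Measure.map_apply hπm hs, hπmp s hs, trim_measurableSet_eq hle hs]
  rw [integral_trim hle hg.stronglyMeasurable, ← hmap]
  exact integral_map_real ν π hπm g hg

/-- Conditional expectation onto a factor, as a function on the factor. -/
lemma exists_condexp {W Y : Type*} [MeasurableSpace W] [MeasurableSpace Y] {m : Measure W}
    [IsProbabilityMeasure m] {ν : Measure Y} {p : W → Y} (hp : MeasurePreserving p m ν)
    {b : W → ℝ} (hb : Measurable b) (hb1 : ∀ w, |b w| ≤ 1) :
    ∃ ψ : Y → ℝ, Measurable ψ ∧ (∀ y, |ψ y| ≤ 1) ∧ ∀ r : Y → ℝ, Measurable r → (∀ y, |r y| ≤ 1) →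
      ∫ w, b w * r (p w) ∂m = ∫ y, ψ y * r y ∂ν := by
  have hle : MeasurableSpace.comap p inferInstance ≤ (inferInstance : MeasurableSpace W) :=
    hp.measurable.comap_le
  have hsm : StronglyMeasurable[MeasurableSpace.comap p inferInstance]
    (m[b | MeasurableSpace.comap p inferInstance]) := stronglyMeasurable_condExp
  obtain ⟨ψ0, hψ0, he⟩ := hsm.exists_eq_measurable_comp
  have hbd : ∀ᵐ w ∂m, |m[b | MeasurableSpace.comap p inferInstance] w| ≤ 1 :=
    ae_bdd_abs_condExp_of_ae_bdd_abs (Eventually.of_forall hb1)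
  have hψm : Measurable (fun y => max (-1) (min 1 (ψ0 y))) :=
    measurable_const.max (measurable_const.min hψ0.measurable)
  refine ⟨fun y => max (-1) (min 1 (ψ0 y)), hψm, fun y => clip_le _, fun r hr hr1 => ?_⟩
  have hrp : StronglyMeasurable[MeasurableSpace.comap p inferInstance] (fun w => r (p w)) :=
    (hr.comp (comap_measurable p)).stronglyMeasurable
  have hbr : Integrable (b * fun w => r (p w)) m :=
    bint (hb.mul (hr.comp hp.measurable)) (fun w => abs_mul_le_one (hb1 w) (hr1 _))
  have h1 := condExp_mul_of_stronglyMeasurable_right hrp hbr (bint (m := m) hb hb1)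
  have h2 : ∫ w, b w * r (p w) ∂m =
      ∫ w, (m[b * fun w => r (p w) | MeasurableSpace.comap p inferInstance]) w ∂m :=
    (integral_condExp hle).symm
  have h3 := integral_map_real m p hp.measurable
    (fun y => max (-1) (min 1 (ψ0 y)) * r y) (hψm.mul hr)
  rw [h2, ← hp.map_eq]
  refine Eq.trans ?_ h3.symm
  refine integral_congr_ae ?_
  filter_upwards [h1, hbd] with w hw hw1
  rw [hw, Pi.mul_apply]
  rw [he] at hw1 ⊢
  simp only [Function.comp] at hw1 ⊢
  rw [clip_eq (abs_le.1 hw1).1 (abs_le.1 hw1).2]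

variable {Γ W Y : Type*} [AddCommGroup Γ] [DecidableEq Γ] [Countable Γ]
  [MeasurableSpace W] [MeasurableSpace Y]

/-- The projection to the factor of (orthogonal to null) times (null) is null. -/
lemma null_of_orth {R : Γ → W → W} {m : Measure W} [IsProbabilityMeasure m] (h : Act R m)
    {S : Γ → Y → Y} {ν : Measure Y} (hS0 : ∀ y, S 0 y = y) (hSm : ∀ g, Measurable (S g))
    {p : W → Y} (hp : MeasurePreserving p m ν)
    (hpR : ∀ g w, p (R g w) = S g (p w)) {d : ℕ} (hd : 0 < d) {f F : W → ℝ}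
    (hF : Measurable F) (hF1 : ∀ w, |F w| ≤ 1)
    (hnull : HKSeminormZero d R m F)
    (horth : ∀ b : W → ℝ, Measurable b → (∃ C, ∀ w, |b w| ≤ C) → HKSeminormZero d R m b →
      ∫ w, f w * b w ∂m = 0)
    (hf : Measurable f) (hf1 : ∀ w, |f w| ≤ 1)
    {ψ : Y → ℝ} (hψ : Measurable ψ) (hψ1 : ∀ y, |ψ y| ≤ 1)
    (hψF : ∀ r : Y → ℝ, Measurable r → (∀ y, |r y| ≤ 1) →
      ∫ w, (f w * F w) * r (p w) ∂m = ∫ y, ψ y * r y ∂ν) :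
    HKSeminormZero d S ν ψ := by
  intro Φ hΦ
  change Tendsto (fun N => avg (Φ N) (fun u => ∫ y, gowersProd d S ψ u y ∂ν)) atTop (nhds 0)
  rw [tendsto_iff_ultrafilter]
  intro U hU
  have hR : ∀ g, Measurable (R g) := fun g => (h.mp g).measurable
  set φ : W → ℝ := fun w => ψ (p w) with hφ
  have hφm : Measurable φ := hψ.comp hp.measurable
  have hφ1 : ∀ w, |φ w| ≤ 1 := fun w => hψ1 _
  set P : (Fin d → Γ) → W → ℝ := fun g w =>
    ∏ s ∈ Finset.univ.erase ∅, φ (R (∑ i ∈ s, g i) w) with hP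
  have hPm : ∀ g, Measurable (P g) := fun g =>
    Finset.measurable_fun_prod _ (fun s _ => hφm.comp (hR _))
  have hP1 : ∀ g w, |P g w| ≤ 1 := fun g w => abs_prod_le_one _ _ fun s _ => hφ1 _
  obtain ⟨D, hDm, hD1, hDlim⟩ := exists_weak_limit (m := m)
    (fun M w => avg (Φ M) (fun g => P g w))
    (fun M => by
      simp only [avg, smul_eq_mul]
      exact (Finset.measurable_fun_sum _ (fun g _ => hPm g)).const_mul _)
    (fun M w => abs_avg_le_const (hΦ.1 M) (fun g _ => hP1 g w)) U
  have hDlim' : ∀ q : W → ℝ, Measurable q → (∀ w, |q w| ≤ 1) →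
      Tendsto (fun M => avg (Φ M) (fun g => ∫ w, q w * P g w ∂m)) U
        (nhds (∫ w, q w * D w ∂m)) := by
    intro q hq hq1
    refine (hDlim q hq hq1).congr fun M => ?_
    rw [avg_integral]
    · refine integral_congr_ae (Eventually.of_forall fun w => ?_)
      simp only [avg, smul_eq_mul, Finset.mul_sum]
      refine Finset.sum_congr rfl fun _ _ => by ring
    · exact fun g => bint (hq.mul (hPm g)) (fun w => abs_mul_le_one (hq1 w) (hP1 g w))
  have hn := null_mul h hd hF hDm hφm hF1 hD1 hφ1 hnull hΦ hU hDlim'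
  have hz := horth _ (hF.mul hDm) ⟨1, fun w => abs_mul_le_one (hF1 w) (hD1 w)⟩ hn
  have hl := hDlim' (fun w => f w * F w) (hf.mul hF) (fun w => abs_mul_le_one (hf1 w) (hF1 w))
  have hz' : ∫ w, f w * F w * D w ∂m = 0 := by
    rw [← hz]
    refine integral_congr_ae (Eventually.of_forall fun w => ?_)
    simp only [mul_assoc, Pi.mul_apply]
  rw [hz'] at hl
  refine hl.congr fun M => avg_congr fun g _ => ?_
  have := hψF (fun y => ∏ s ∈ Finset.univ.erase ∅, ψ (S (∑ i ∈ s, g i) y))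
    (Finset.measurable_fun_prod _ (fun s _ => hψ.comp (hSm _)))
    (fun y => abs_prod_le_one _ _ fun s _ => hψ1 _)
  simp only [hP, hφ, hpR, this, gowersProd, prod_erase_empty, Finset.sum_empty, hS0]

lemma ae_eq_of_rect {X Y : Type*} [MeasurableSpace X] [MeasurableSpace Y] {m : Measure (X × Y)}
    [IsProbabilityMeasure m] {f g : X × Y → ℝ} (hf : Integrable f m) (hg : Integrable g m)
    (h : ∀ (A : Set X) (B : Set Y), MeasurableSet A → MeasurableSet B →
      ∫ w in A ×ˢ B, f w ∂m = ∫ w in A ×ˢ B, g w ∂m) : f =ᵐ[m] g := by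
  refine Integrable.ae_eq_of_forall_setIntegral_eq _ _ hf hg fun s hs _ => ?_
  have huniv : ∫ w, f w ∂m = ∫ w, g w ∂m := by
    have := h Set.univ Set.univ MeasurableSet.univ MeasurableSet.univ
    simpa [Set.univ_prod_univ] using this
  induction s, hs using MeasurableSpace.induction_on_inter generateFrom_prod.symm
    isPiSystem_prod with
  | empty => simp
  | basic t ht =>
    obtain ⟨A, hA, B, hB, rfl⟩ := ht
    exact h A B hA hB
  | compl t htm ih =>
    have a := integral_add_compl htm hf
    have b := integral_add_compl htm hg
    have := ih (measure_lt_top _ _)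
    linarith
  | iUnion t hd hm ih =>
    rw [integral_iUnion hm hd hf.integrableOn, integral_iUnion hm hd hg.integrableOn]
    exact tsum_congr fun i => ih i (measure_lt_top _ _)

end final

end HKaux

/-- Lifting extensions of Host–Kra factors: let `X` be an ergodic `Γ`-system whose `k`-th
Host–Kra factor is the invariant sub-σ-algebra `𝒵` (characterized via vanishing of the
`U^{k+1}` seminorm), let `(Y, ν, S)` be an ergodic system of order `k` extending the factor
`(X, 𝒵)` via `π : Y → X`, and let `lam` be the relatively independent joining of `X` and `Y`
over the common factor. Then every bounded measurable function on the joining which is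
measurable with respect to the order-`k` Host–Kra factor of the joining (equivalently,
orthogonal to every bounded function with vanishing `U^{k+1}` seminorm) coincides a.e. with a
function of the second coordinate, i.e. is measurable with respect to the factor `Y`. -/
theorem host_kra_factor_of_relative_joining
    {Γ : Type*} [AddCommGroup Γ] [Countable Γ] [DecidableEq Γ] (k : ℕ)
    {X : Type*} (𝒵 : MeasurableSpace X) [mX : MeasurableSpace X]
    (μ : Measure X) [IsProbabilityMeasure μ]
    (T : Γ → X → X) (hTm : ∀ g, Measurable (T g))
    (hT0 : ∀ x, T 0 x = x) (hTadd : ∀ g h x, T (g + h) x = T g (T h x))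
    (hTmp : ∀ g, MeasurePreserving (T g) μ μ)
    (hXerg : ∀ s : Set X, MeasurableSet s → (∀ g, T g ⁻¹' s =ᵐ[μ] s) → μ s = 0 ∨ μ s = 1)
    -- the k-th Host–Kra factor of X is 𝒵
    (h𝒵le : 𝒵 ≤ mX)
    (h𝒵inv : ∀ g, ∀ s : Set X, MeasurableSet[𝒵] s → MeasurableSet[𝒵] (T g ⁻¹' s))
    (h𝒵char : ∀ f : X → ℝ, Measurable f → (∃ C, ∀ x, |f x| ≤ C) →
      (HKSeminormZero (k + 1) T μ f ↔ μ[f|𝒵] =ᵐ[μ] 0))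
    -- the ergodic order-k system Y (the extension Z̃ᵏ of Zᵏ)
    {Y : Type*} [MeasurableSpace Y] (ν : Measure Y) [IsProbabilityMeasure ν]
    (S : Γ → Y → Y) (hSm : ∀ g, Measurable (S g))
    (hS0 : ∀ y, S 0 y = y) (hSadd : ∀ g h y, S (g + h) y = S g (S h y))
    (hSmp : ∀ g, MeasurePreserving (S g) ν ν)
    (hYerg : ∀ s : Set Y, MeasurableSet s → (∀ g, S g ⁻¹' s =ᵐ[ν] s) → ν s = 0 ∨ ν s = 1)
    (hYorder : ∀ f : Y → ℝ, Measurable f → (∃ C, ∀ y, |f y| ≤ C) →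
      (HKSeminormZero (k + 1) S ν f ↔ f =ᵐ[ν] 0))
    -- Y extends the factor (X, 𝒵) via π
    (π : Y → X) (hπm : @Measurable Y X _ 𝒵 π)
    (hπmp : ∀ s : Set X, MeasurableSet[𝒵] s → ν (π ⁻¹' s) = μ s)
    (hπeq : ∀ g, ∀ᵐ y ∂ν, π (S g y) = T g (π y))
    -- the relatively independent joining of X and Y over the common factor
    (lam : Measure (X × Y)) [IsProbabilityMeasure lam]
    (hlaminv : ∀ g, MeasurePreserving (fun p : X × Y => (T g p.1, S g p.2)) lam lam)
    (hlam : ∀ (f₁ : X → ℝ) (f₂ : Y → ℝ), Measurable f₁ → Measurable f₂ →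
      (∃ C, ∀ x, |f₁ x| ≤ C) → (∃ C, ∀ y, |f₂ y| ≤ C) →
      ∀ g₂ : X → ℝ, Measurable[𝒵] g₂ →
        (ν[f₂ | MeasurableSpace.comap π 𝒵] =ᵐ[ν] fun y => g₂ (π y)) →
        ∫ p, f₁ p.1 * f₂ p.2 ∂lam = ∫ x, (μ[f₁|𝒵]) x * g₂ x ∂μ) :
    -- conclusion: order-k HK-measurable functions on the joining depend only on Y
    ∀ f : X × Y → ℝ, Measurable f → (∃ C, ∀ p, |f p| ≤ C) →
      (∀ h : X × Y → ℝ, Measurable h → (∃ C, ∀ p, |h p| ≤ C) →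
        HKSeminormZero (k + 1) (fun g p => (T g p.1, S g p.2)) lam h →
        ∫ p, f p * h p ∂lam = 0) →
      ∃ f₂ : Y → ℝ, Measurable f₂ ∧ f =ᵐ[lam] fun p => f₂ p.2 := by
  have hmZ : MeasurableSpace.comap π 𝒵 ≤ ‹MeasurableSpace Y› := hπm.comap_le
  set R : Γ → X × Y → X × Y := fun g p => (T g p.1, S g p.2) with hRdef
  have hact : HKaux.Act R lam :=
    ⟨fun w => by simp [hRdef, hT0, hS0], fun g h w => by simp [hRdef, hTadd, hSadd], hlaminv⟩
  have h𝒵m : ∀ {g : X → ℝ}, Measurable[𝒵] g → Measurable g := fun hg => hg.mono h𝒵le le_rfl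
  have hfac : ∀ r : Y → ℝ, ∃ g₂ : X → ℝ, Measurable[𝒵] g₂ ∧
      ν[r | MeasurableSpace.comap π 𝒵] = fun y => g₂ (π y) := by
    intro r
    have hsm : StronglyMeasurable[MeasurableSpace.comap π 𝒵]
      (ν[r | MeasurableSpace.comap π 𝒵]) := stronglyMeasurable_condExp
    obtain ⟨g, hg, he⟩ := StronglyMeasurable.exists_eq_measurable_comp (mY := 𝒵) hsm
    exact ⟨g, hg.measurable, he⟩
  -- marginals
  have hfst : ∀ r : X → ℝ, Measurable r → (∃ C, ∀ x, |r x| ≤ C) →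
      ∫ p, r p.1 ∂lam = ∫ x, r x ∂μ := by
    intro r hr hrb
    have := hlam r (fun _ => 1) hr measurable_const hrb ⟨1, fun _ => by simp⟩ (fun _ => 1)
      measurable_const (by rw [condExp_const hmZ])
    simp only [mul_one] at this
    rw [this, integral_condExp h𝒵le]
  have hsnd : ∀ r : Y → ℝ, Measurable r → (∃ C, ∀ y, |r y| ≤ C) →
      ∫ p, r p.2 ∂lam = ∫ y, r y ∂ν := by
    intro r hr hrb
    obtain ⟨g₂, hg₂, he⟩ := hfac r
    have := hlam (fun _ => 1) r measurable_const hr ⟨1, fun _ => by simp⟩ hrb g₂ hg₂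
      (by rw [he])
    rw [condExp_const h𝒵le] at this
    simp only [one_mul] at this
    rw [this, HKaux.integral_factor h𝒵le μ ν π hπm hπmp g₂ hg₂, ← integral_condExp (f := r) hmZ, he]
  have hp2 : MeasurePreserving (Prod.snd : X × Y → Y) lam ν := by
    refine ⟨measurable_snd, Measure.ext fun s hs => ?_⟩
    have := hsnd (s.indicator 1) (measurable_one.indicator hs)
      ⟨1, fun y => by by_cases hy : y ∈ s <;> simp [hy]⟩
    have e : (fun p : X × Y => s.indicator (1 : Y → ℝ) p.2) =
        (Prod.snd ⁻¹' s).indicator 1 := by ext p; rfl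
    rw [e, integral_indicator_one (measurable_snd hs), integral_indicator_one hs,
      measureReal_eq_measureReal_iff] at this
    rw [Measure.map_apply measurable_snd hs, this]
  -- pull back of null functions
  have hnullfst : ∀ r : X → ℝ, Measurable r → (∀ x, |r x| ≤ 1) →
      HKSeminormZero (k + 1) T μ r → HKSeminormZero (k + 1) R lam (fun p => r p.1) := by
    intro r hr hr1 hn
    have : (fun gs : Fin (k + 1) → Γ => ∫ p, gowersProd (k + 1) R (fun p => r p.1) gs p ∂lam) =
        fun gs => ∫ x, gowersProd (k + 1) T r gs x ∂μ := by
      funext gs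
      exact hfst (fun x => gowersProd (k + 1) T r gs x)
        (Finset.measurable_fun_prod _ (fun s _ => hr.comp (hTm _)))
        ⟨1, fun x => HKaux.abs_prod_le_one _ _ fun s _ => hr1 _⟩
    unfold HKSeminormZero
    rw [this]
    exact hn
  -- 𝒵-measurable functions agree
  have hcross : ∀ e : X → ℝ, Measurable[𝒵] e → (∀ x, |e x| ≤ 1) →
      ∀ᵐ p ∂lam, e p.1 = e (π p.2) := by
    intro e he he1
    have hem := h𝒵m he
    have heπ : Measurable (fun y => e (π y)) := he.comp hπm
    have heπc : Measurable[MeasurableSpace.comap π 𝒵] (fun y => e (π y)) :=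
      he.comp (comap_measurable π)
    have h2 : ∀ x, |e x ^ 2| ≤ 1 := fun x => by
      rw [abs_pow]; exact pow_le_one₀ (abs_nonneg _) (he1 x)
    have i1 := hfst (fun x => e x ^ 2) (hem.pow_const 2) ⟨1, h2⟩
    have i2 := hsnd (fun y => e (π y) ^ 2) (heπ.pow_const 2) ⟨1, fun y => h2 _⟩
    rw [← HKaux.integral_factor h𝒵le μ ν π hπm hπmp (fun x => e x ^ 2) (he.pow_const 2)] at i2
    have i3 := hlam e (fun y => e (π y)) hem heπ ⟨1, he1⟩ ⟨1, fun y => he1 _⟩ e he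
      (by rw [condExp_of_stronglyMeasurable hmZ heπc.stronglyMeasurable
            (HKaux.bint heπ (fun y => he1 _))])
    rw [condExp_of_stronglyMeasurable h𝒵le he.stronglyMeasurable (HKaux.bint hem he1)] at i3
    have m1 : Measurable (fun p : X × Y => e p.1) := hem.comp measurable_fst
    have m2 : Measurable (fun p : X × Y => e (π p.2)) := heπ.comp measurable_snd
    have j1 : Integrable (fun p : X × Y => e p.1 ^ 2) lam :=
      HKaux.bint (m1.pow_const 2) (fun p => h2 _)
    have j2 : Integrable (fun p : X × Y => e (π p.2) ^ 2) lam :=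
      HKaux.bint (m2.pow_const 2) (fun p => h2 _)
    have j3 : Integrable (fun p : X × Y => 2 * (e p.1 * e (π p.2))) lam :=
      (HKaux.bint (m1.mul m2) (fun p => HKaux.abs_mul_le_one (he1 _) (he1 _))).const_mul 2
    have j4 : Integrable (fun p : X × Y => e p.1 ^ 2 + e (π p.2) ^ 2) lam := j1.add j2
    have hz : ∫ p, (e p.1 - e (π p.2)) ^ 2 ∂lam = 0 := by
      have : ∀ p : X × Y, (e p.1 - e (π p.2)) ^ 2 =
        e p.1 ^ 2 + e (π p.2) ^ 2 - 2 * (e p.1 * e (π p.2)) := fun p => by ring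
      simp only [this]
      rw [integral_sub j4 j3, integral_add j1 j2, integral_const_mul, i1, i2, i3]
      have : ∀ x, e x * e x = e x ^ 2 := fun x => by ring
      simp only [this]; ring
    have j5 : Integrable (fun p : X × Y => (e p.1 - e (π p.2)) ^ 2) lam := by
      refine (j4.sub j3).congr (Eventually.of_forall fun p => ?_)
      simp only [Pi.sub_apply]; ring
    have := (integral_eq_zero_iff_of_nonneg (fun p => sq_nonneg _) j5).1 hz
    filter_upwards [this] with p hp
    have hp' : (e p.1 - e (π p.2)) ^ 2 = 0 := hp
    exact sub_eq_zero.1 (pow_eq_zero_iff (two_ne_zero) |>.1 hp')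
  -- the normalized statement
  have core : ∀ f : X × Y → ℝ, Measurable f → (∀ p, |f p| ≤ 1) →
      (∀ h : X × Y → ℝ, Measurable h → (∃ C, ∀ p, |h p| ≤ C) →
        HKSeminormZero (k + 1) R lam h → ∫ p, f p * h p ∂lam = 0) →
      ∃ f₂ : Y → ℝ, Measurable f₂ ∧ f =ᵐ[lam] fun p => f₂ p.2 := by
    intro f hf hf1 horth
    obtain ⟨q, hqm, hq1, hq⟩ := HKaux.exists_condexp hp2 hf hf1
    refine ⟨q, hqm, HKaux.ae_eq_of_rect (HKaux.bint hf hf1)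
      (HKaux.bint (hqm.comp measurable_snd) (fun p => hq1 _)) fun A B hA hB => ?_⟩
    -- decompose the indicator of `A`
    set a : X → ℝ := A.indicator 1 with ha
    have ham : Measurable a := measurable_one.indicator hA
    have ha01 : ∀ x, 0 ≤ a x ∧ a x ≤ 1 := fun x => by by_cases hx : x ∈ A <;> simp [ha, hx]
    have ha1 : ∀ x, |a x| ≤ 1 := fun x => by rw [abs_of_nonneg (ha01 x).1]; exact (ha01 x).2
    set r : Y → ℝ := B.indicator 1 with hr
    have hrm : Measurable r := measurable_one.indicator hB
    have hr1 : ∀ y, |r y| ≤ 1 := fun y => by by_cases hy : y ∈ B <;> simp [hr, hy]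
    set e : X → ℝ := fun x => max 0 (min 1 ((μ[a|𝒵]) x)) with he
    have hem : Measurable[𝒵] e := by
      have h0 : Measurable[𝒵] (μ[a|𝒵]) := stronglyMeasurable_condExp.measurable
      exact measurable_const.max (measurable_const.min h0)
    have hem' := h𝒵m hem
    have he01 : ∀ x, 0 ≤ e x ∧ e x ≤ 1 := fun x =>
      ⟨le_max_left _ _, max_le zero_le_one (min_le_left _ _)⟩
    have he1 : ∀ x, |e x| ≤ 1 := fun x => by rw [abs_of_nonneg (he01 x).1]; exact (he01 x).2
    have hia : Integrable a μ := HKaux.bint ham ha1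
    have hie : Integrable e μ := HKaux.bint hem' he1
    have hee : e =ᵐ[μ] μ[a|𝒵] := by
      have b1 : 0 ≤ᵐ[μ] μ[a|𝒵] := condExp_nonneg (Eventually.of_forall fun x => (ha01 x).1)
      have b2 : ∀ᵐ x ∂μ, |(μ[a|𝒵]) x| ≤ 1 :=
        ae_bdd_abs_condExp_of_ae_bdd_abs (Eventually.of_forall ha1)
      filter_upwards [b1, b2] with x h1 h2
      have h1' : 0 ≤ (μ[a|𝒵]) x := h1
      simp only [he]
      rw [min_eq_right (abs_le.1 h2).2, max_eq_right h1']
    set F : X → ℝ := fun x => a x - e x with hF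
    have hFm : Measurable F := ham.sub hem'
    have hF1 : ∀ x, |F x| ≤ 1 := fun x => by
      have := ha01 x; have := he01 x
      rw [abs_le]; constructor <;> simp only [hF] <;> linarith
    have hF0 : μ[F|𝒵] =ᵐ[μ] 0 := by
      have c1 : μ[F|𝒵] =ᵐ[μ] μ[a|𝒵] - μ[e|𝒵] := condExp_sub hia hie 𝒵
      rw [condExp_of_stronglyMeasurable h𝒵le hem.stronglyMeasurable hie] at c1
      filter_upwards [c1, hee] with x h1 h2
      rw [h1]; simp [h2]
    have hFnull := hnullfst F hFm hF1 ((h𝒵char F hFm ⟨1, hF1⟩).2 hF0)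
    have hFm2 : Measurable (fun p : X × Y => F p.1) := hFm.comp measurable_fst
    have hrm2 : Measurable (fun p : X × Y => r p.2) := hrm.comp measurable_snd
    have hem2 : Measurable (fun p : X × Y => e p.1) := hem'.comp measurable_fst
    have hqm2 : Measurable (fun p : X × Y => q p.2) := hqm.comp measurable_snd
    have heπ : Measurable (fun y => e (π y)) := hem.comp hπm
    -- the null part
    obtain ⟨ψ, hψm, hψ1, hψ⟩ := HKaux.exists_condexp hp2 (hf.mul hFm2)
      (fun p => HKaux.abs_mul_le_one (hf1 p) (hF1 _))
    have hψnull := HKaux.null_of_orth hact hS0 hSm hp2 (fun g w => rfl) (Nat.succ_pos k) hFm2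
      (fun p => hF1 _) hFnull horth hf hf1 hψm hψ1 hψ
    have hψ0 := (hYorder ψ hψm ⟨1, hψ1⟩).1 hψnull
    have i1 : ∫ p, f p * F p.1 * r p.2 ∂lam = 0 := by
      have h1 : ∫ p, f p * F p.1 * r p.2 ∂lam = ∫ y, ψ y * r y ∂ν := hψ r hrm hr1
      rw [h1, integral_eq_zero_of_ae]
      filter_upwards [hψ0] with y hy
      simp [hy]
    have i3 : ∫ p, F p.1 * (q p.2 * r p.2) ∂lam = 0 := by
      obtain ⟨g₂, hg₂, hg⟩ := hfac (fun y => q y * r y)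
      rw [hlam F (fun y => q y * r y) hFm (hqm.mul hrm) ⟨1, hF1⟩
        ⟨1, fun y => HKaux.abs_mul_le_one (hq1 y) (hr1 y)⟩ g₂ hg₂ (by rw [hg]),
        integral_eq_zero_of_ae]
      filter_upwards [hF0] with x hx
      simp [hx]
    have hc := hcross e hem he1
    have i2 : ∫ p, f p * (e p.1 * r p.2) ∂lam = ∫ p, q p.2 * (e p.1 * r p.2) ∂lam := by
      have t1 : ∫ p, f p * (e p.1 * r p.2) ∂lam = ∫ p, f p * (e (π p.2) * r p.2) ∂lam := by
        refine integral_congr_ae ?_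
        filter_upwards [hc] with p hp
        rw [hp]
      have t2 : ∫ p, q p.2 * (e p.1 * r p.2) ∂lam = ∫ p, q p.2 * (e (π p.2) * r p.2) ∂lam := by
        refine integral_congr_ae ?_
        filter_upwards [hc] with p hp
        rw [hp]
      have hb : ∀ y, |e (π y) * r y| ≤ 1 := fun y => HKaux.abs_mul_le_one (he1 _) (hr1 y)
      rw [t1, t2, hq (fun y => e (π y) * r y) (heπ.mul hrm) hb]
      exact (hsnd (fun y => q y * (e (π y) * r y)) (hqm.mul (heπ.mul hrm))
        ⟨1, fun y => HKaux.abs_mul_le_one (hq1 y) (hb y)⟩).symm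
    have hrect : ∀ g : X × Y → ℝ, ∫ w in A ×ˢ B, g w ∂lam = ∫ p, g p * (a p.1 * r p.2) ∂lam := by
      intro g
      rw [← integral_indicator (hA.prod hB)]
      refine integral_congr_ae (Eventually.of_forall fun p => ?_)
      by_cases h1 : p.1 ∈ A <;> by_cases h2 : p.2 ∈ B <;>
        simp [ha, hr, Set.indicator, h1, h2]
    have hsplit : ∀ g : X × Y → ℝ, Measurable g → (∀ p, |g p| ≤ 1) →
        ∫ p, g p * (a p.1 * r p.2) ∂lam =
          ∫ p, g p * F p.1 * r p.2 ∂lam + ∫ p, g p * (e p.1 * r p.2) ∂lam := by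
      intro g hg hg1
      rw [← integral_add]
      · refine integral_congr_ae (Eventually.of_forall fun p => ?_)
        simp only [hF]; ring
      · exact HKaux.bint ((hg.mul hFm2).mul hrm2) fun p =>
          HKaux.abs_mul_le_one (HKaux.abs_mul_le_one (hg1 p) (hF1 _)) (hr1 _)
      · exact HKaux.bint (hg.mul (hem2.mul hrm2)) fun p =>
          HKaux.abs_mul_le_one (hg1 p) (HKaux.abs_mul_le_one (he1 _) (hr1 _))
    rw [hrect, hrect, hsplit f hf hf1, hsplit (fun p => q p.2) hqm2 (fun p => hq1 _), i1, i2]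
    have i3' : ∫ p, q p.2 * F p.1 * r p.2 ∂lam = 0 := by
      rw [← i3]
      refine integral_congr_ae (Eventually.of_forall fun p => ?_)
      simp only; ring
    rw [i3']
  -- scaling
  intro f hf hfb horth
  obtain ⟨C, hC⟩ := hfb
  have hC0 : 0 < |C| + 1 := by positivity
  obtain ⟨f₂, hf₂, he⟩ := core (fun p => (|C| + 1)⁻¹ * f p) (hf.const_mul _)
    (fun p => by
      rw [abs_mul, abs_of_pos (inv_pos.2 hC0), inv_mul_le_iff₀ hC0]
      have := hC p; have := le_abs_self C; linarith)
    (fun h hh hb hn => by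
      simp only [mul_assoc]
      rw [integral_const_mul, horth h hh hb hn, mul_zero])
  refine ⟨fun y => (|C| + 1) * f₂ y, hf₂.const_mul _, ?_⟩
  filter_upwards [he] with p hp
  have hp' : (|C| + 1)⁻¹ * f p = f₂ p.2 := hp
  rw [← hp', mul_inv_cancel_left₀ hC0.ne']
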